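/- Let d ≥ 1, p ∈ [1, ∞), β ∈ (2, ∞), L > 0, and let f_3(s) = (d−1)!·(d+1)·‖s‖₁ for s ∈ S_d. Then f_3 ∈ Σ(d, β, L), and there exists a constant c > 0 depending only on d and p such that for all b ∈ (0,1) and all n, E_3(‖f̂_{n,b} − f_3‖_p^p) ≥ c · b^p. -/

import Mathlib

open MeasureTheory Filter Topology
open scoped ENNReal BigOperators

noncomputable section

/-- The d-dimensional simplex `S_d = {s ∈ [0,1]^d : s_1 + ⋯ + s_d ≤ 1}`. -/
def Sd (d : ℕ) : Set (Fin d → ℝ) :=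
  {s | (∀ i, 0 ≤ s i ∧ s i ≤ 1) ∧ ∑ i, s i ≤ 1}

/-- The Dirichlet density `K_{u,v}` on `S_d` (0 outside). -/
def dirK (d : ℕ) (u : Fin d → ℝ) (v : ℝ) : (Fin d → ℝ) → ℝ :=
  Set.indicator (Sd d)
    (fun s => Real.Gamma (v + ∑ i, u i) / (Real.Gamma v * ∏ i, Real.Gamma (u i)) *
      (1 - ∑ i, s i) ^ (v - 1) * ∏ i, (s i) ^ (u i - 1))

/-- The Dirichlet kernel `K_{s/b+1, (1-‖s‖₁)/b+1}` at location `s` with bandwidth `b`. -/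
def dirKb (d : ℕ) (b : ℝ) (s : Fin d → ℝ) : (Fin d → ℝ) → ℝ :=
  dirK d (fun i => s i / b + 1) ((1 - ∑ i, s i) / b + 1)

/-- The Dirichlet kernel density estimator based on the sample `X`. -/
def fhat (d n : ℕ) (b : ℝ) (X : Fin n → Fin d → ℝ) (s : Fin d → ℝ) : ℝ :=
  (n : ℝ)⁻¹ * ∑ i, dirKb d b s (X i)

/-- `m` = the largest integer strictly less than `β` (for `β > 0`). -/
def mOf (β : ℝ) : ℕ := ⌈β⌉₊ - 1

/-- Partial derivative of order `j` in the directions `v` (on the interior of the simplex). -/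
def Dpartial (d j : ℕ) (f : (Fin d → ℝ) → ℝ) (v : Fin j → Fin d) (s : Fin d → ℝ) : ℝ :=
  iteratedFDerivWithin ℝ j f (interior (Sd d)) s fun i => Pi.single (v i) 1

/-- The Hölder class `Σ(d, β, L)` of probability densities supported on `S_d`. -/
def holderClass (d : ℕ) (β L : ℝ) : Set ((Fin d → ℝ) → ℝ) :=
  {f | (∀ s, 0 ≤ f s) ∧ (∀ s, s ∉ Sd d → f s = 0) ∧ (∫ s in Sd d, f s) = 1 ∧
    ContDiffOn ℝ (mOf β) f (interior (Sd d)) ∧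
    ∀ v : Fin (mOf β) → Fin d, ∀ s ∈ interior (Sd d), ∀ t ∈ interior (Sd d),
      |Dpartial d (mOf β) f v s - Dpartial d (mOf β) f v t| ≤
        L * (∑ i, |s i - t i|) ^ (β - (mOf β : ℝ))}

/-- `E_f ‖f̂_{n,b} − f‖_p^p`: expectation, under i.i.d. sampling of `X_1, …, X_n` from the
density `f`, of the `p`-th power of the `L^p` distance between `f̂_{n,b}` and `f` on `S_d`. -/
def lpRiskPow (d n : ℕ) (b p : ℝ) (f : (Fin d → ℝ) → ℝ) : ℝ :=
  ∫ ω : Fin n → Fin d → ℝ,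
    (∏ i, f (ω i)) * ∫ s in Sd d, |fhat d n b ω s - f s| ^ p

/-- The density `f_3(s) = (d-1)! (d+1) ‖s‖₁` on the simplex `S_d`. -/
def f3 (d : ℕ) : (Fin d → ℝ) → ℝ :=
  Set.indicator (Sd d) (fun s => (Nat.factorial (d - 1) : ℝ) * ((d : ℝ) + 1) * ∑ i, s i)

lemma beta_scaled_real {u w T : ℝ} (hu : 1 ≤ u) (hw : 1 ≤ w) (hT : 0 ≤ T) :
    ∫ x in (0:ℝ)..T, x ^ (u - 1) * (T - x) ^ (w - 1) =
      T ^ (u + w - 1) * (Real.Gamma u * Real.Gamma w / Real.Gamma (u + w)) := by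
  rcases hT.eq_or_lt with rfl | hT
  · rw [Real.zero_rpow (by linarith)]; simp
  have h := Complex.betaIntegral_scaled (u : ℂ) (w : ℂ) hT
  rw [Complex.betaIntegral_eq_Gamma_mul_div _ _ (by simp; linarith) (by simp; linarith)] at h
  have h2 : ∫ x in (0:ℝ)..T, (x : ℂ) ^ ((u:ℂ) - 1) * ((T : ℂ) - x) ^ ((w:ℂ) - 1) =
      ∫ x in (0:ℝ)..T, ((x ^ (u - 1) * (T - x) ^ (w - 1) : ℝ) : ℂ) := by
    apply intervalIntegral.integral_congr
    intro x hx
    rw [Set.uIcc_of_le hT.le] at hx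
    simp only
    push_cast
    rw [Complex.ofReal_cpow hx.1, Complex.ofReal_cpow (by linarith [hx.2])]
    push_cast; rfl
  rw [h2, intervalIntegral.integral_ofReal] at h
  have h3 : ((T:ℂ) ^ ((u:ℂ) + w - 1)) * (Complex.Gamma u * Complex.Gamma w / Complex.Gamma (u + w))
      = ((T ^ (u + w - 1) * (Real.Gamma u * Real.Gamma w / Real.Gamma (u + w)) : ℝ) : ℂ) := by
    push_cast
    rw [Complex.ofReal_cpow hT.le, ← Complex.ofReal_add, Complex.Gamma_ofReal, Complex.Gamma_ofReal,
      Complex.Gamma_ofReal]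
    push_cast; rfl
  rw [h3] at h
  exact_mod_cast h

lemma beta_scaled_lintegral {u w T : ℝ} (hu : 1 ≤ u) (hw : 1 ≤ w) (hT : 0 ≤ T) :
    ∫⁻ x in Set.Icc 0 T, ENNReal.ofReal (x ^ (u - 1) * (T - x) ^ (w - 1)) =
      ENNReal.ofReal (T ^ (u + w - 1) * (Real.Gamma u * Real.Gamma w / Real.Gamma (u + w))) := by
  rw [← beta_scaled_real hu hw hT, intervalIntegral.integral_of_le hT, ← integral_Icc_eq_integral_Ioc,
    ofReal_integral_eq_lintegral_ofReal]
  · apply Continuous.integrableOn_Icc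
    exact (Real.continuous_rpow_const (by linarith)).mul
      ((Real.continuous_rpow_const (by linarith)).comp (continuous_const.sub continuous_id))
  · filter_upwards [ae_restrict_mem measurableSet_Icc] with x hx
    exact mul_nonneg (Real.rpow_nonneg hx.1 _) (Real.rpow_nonneg (by linarith [hx.2]) _)

/-- scaled simplex -/
def scSet (d : ℕ) (T : ℝ) : Set (Fin d → ℝ) := {x | (∀ i, 0 ≤ x i) ∧ ∑ i, x i ≤ T}

lemma scSet_closed (d : ℕ) (T : ℝ) : IsClosed (scSet d T) := by
  have : scSet d T = (⋂ i, {x | 0 ≤ x i}) ∩ {x | ∑ i, x i ≤ T} := by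
    ext x; simp [scSet]
  rw [this]
  refine (isClosed_iInter fun i => isClosed_le (by fun_prop) (by fun_prop)).inter
    (isClosed_le (by fun_prop) (by fun_prop))

lemma Sd_eq_scSet (d : ℕ) : Sd d = scSet d 1 := by
  ext x
  simp only [Sd, scSet, Set.mem_ofPred_eq]
  constructor
  · rintro ⟨h, h'⟩; exact ⟨fun i => (h i).1, h'⟩
  · rintro ⟨h, h'⟩
    exact ⟨fun i => ⟨h i, (Finset.single_le_sum (f := x) (fun j _ => h j) (Finset.mem_univ i)).trans h'⟩, h'⟩

/-- unnormalised Dirichlet density on the scaled simplex -/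
def dirF (d : ℕ) (T : ℝ) (u : Fin d → ℝ) (v : ℝ) : (Fin d → ℝ) → ℝ≥0∞ :=
  (scSet d T).indicator fun x =>
    ENNReal.ofReal ((T - ∑ i, x i) ^ (v - 1) * ∏ i, (x i) ^ (u i - 1))

lemma dirF_meas (d : ℕ) (T : ℝ) (u : Fin d → ℝ) (v : ℝ) : Measurable (dirF d T u v) := by
  refine Measurable.indicator ?_ (scSet_closed d T).measurableSet
  fun_prop

lemma dirF_cons (d : ℕ) (T : ℝ) (u : Fin (d+1) → ℝ) (v : ℝ) (x : ℝ) (y : Fin d → ℝ) :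
    dirF (d+1) T u v (Fin.cons x y) =
      (Set.Icc 0 T).indicator (fun x => ENNReal.ofReal (x ^ (u 0 - 1)) *
        dirF d (T - x) (fun i => u i.succ) v y) x := by
  by_cases h : (Fin.cons x y : Fin (d+1) → ℝ) ∈ scSet (d+1) T
  · have h' := h
    simp only [scSet, Set.mem_ofPred_eq, Fin.forall_fin_succ, Fin.cons_zero, Fin.cons_succ,
      Fin.sum_univ_succ] at h'
    obtain ⟨⟨h0, h1⟩, h2⟩ := h'
    have h3 : 0 ≤ ∑ i, y i := Finset.sum_nonneg fun i _ => h1 i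
    have hy : y ∈ scSet d (T - x) := ⟨h1, by linarith⟩
    rw [dirF, Set.indicator_of_mem h, Set.indicator_of_mem (show x ∈ Set.Icc 0 T from ⟨h0, by linarith⟩),
      dirF, Set.indicator_of_mem hy, ← ENNReal.ofReal_mul (Real.rpow_nonneg h0 _)]
    simp only [Fin.sum_univ_succ, Fin.prod_univ_succ, Fin.cons_zero, Fin.cons_succ]
    congr 1
    rw [sub_sub]; ring
  · rw [dirF, Set.indicator_of_notMem h]
    by_cases hx : x ∈ Set.Icc 0 T
    · rw [Set.indicator_of_mem hx]
      have hy : y ∉ scSet d (T - x) := by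
        intro hy
        apply h
        simp only [scSet, Set.mem_ofPred_eq, Fin.forall_fin_succ, Fin.cons_zero, Fin.cons_succ,
          Fin.sum_univ_succ]
        exact ⟨⟨hx.1, hy.1⟩, by linarith [hy.2]⟩
      rw [dirF, Set.indicator_of_notMem hy, mul_zero]
    · rw [Set.indicator_of_notMem hx]

lemma lintegral_dirF (d : ℕ) : ∀ (T : ℝ) (_ : 0 ≤ T) (u : Fin d → ℝ) (_ : ∀ i, 1 ≤ u i)
    (v : ℝ) (_ : 1 ≤ v),
    ∫⁻ x, dirF d T u v x = ENNReal.ofReal (T ^ (v + ∑ i, u i - 1) *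
      (Real.Gamma v * ∏ i, Real.Gamma (u i)) / Real.Gamma (v + ∑ i, u i)) := by
  induction d with
  | zero =>
    intro T hT u hu v hv
    have hG : Real.Gamma v ≠ 0 := (Real.Gamma_pos_of_pos (by linarith)).ne'
    rw [lintegral_unique]
    simp [dirF, scSet, hT, hG, volume_pi]
  | succ d ih =>
    intro T hT u hu v hv
    have hmp := (volume_preserving_piFinSuccAbove (fun _ : Fin (d+1) => ℝ) 0).symm
    rw [← hmp.lintegral_comp (dirF_meas _ _ _ _)]
    rw [Measure.volume_eq_prod, lintegral_prod _ (by
      exact ((dirF_meas _ _ _ _).comp (MeasurableEquiv.measurable _)).aemeasurable)]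
    have e : ∀ (x : ℝ) (y : Fin d → ℝ),
      (MeasurableEquiv.piFinSuccAbove (fun _ : Fin (d+1) => ℝ) 0).symm (x, y) = Fin.cons x y := by
      intro x y
      simp [MeasurableEquiv.piFinSuccAbove, Fin.insertNthEquiv]
    simp only [e, dirF_cons]
    set w := v + ∑ i : Fin d, u i.succ with hw
    have hw1 : 1 ≤ w := by
      have : 0 ≤ ∑ i : Fin d, u i.succ := Finset.sum_nonneg fun i _ => by linarith [hu i.succ]
      linarith
    set c := (Real.Gamma v * ∏ i : Fin d, Real.Gamma (u i.succ)) / Real.Gamma w with hc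
    have hc0 : 0 ≤ c := by
      refine div_nonneg (mul_nonneg (Real.Gamma_pos_of_pos (by linarith)).le
        (Finset.prod_nonneg fun i _ => (Real.Gamma_pos_of_pos (by linarith [hu i.succ])).le))
        (Real.Gamma_pos_of_pos (by linarith)).le
    have key : ∀ x, ∫⁻ y, (Set.Icc 0 T).indicator (fun x => ENNReal.ofReal (x ^ (u 0 - 1)) *
        dirF d (T - x) (fun i => u i.succ) v y) x = (Set.Icc 0 T).indicator (fun x =>
          ENNReal.ofReal (x ^ (u 0 - 1) * (T - x) ^ (w - 1)) * ENNReal.ofReal c) x := by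
      intro x
      by_cases hx : x ∈ Set.Icc 0 T
      · simp only [Set.indicator_of_mem hx]
        rw [lintegral_const_mul _ (dirF_meas _ _ _ _),
          ih (T - x) (by linarith [hx.2]) _ (fun i => hu _) v hv,
          ← ENNReal.ofReal_mul (Real.rpow_nonneg hx.1 _), ← ENNReal.ofReal_mul
            (mul_nonneg (Real.rpow_nonneg hx.1 _) (Real.rpow_nonneg (by linarith [hx.2]) _))]
        congr 1
        rw [hc, hw]; ring
      · simp only [Set.indicator_of_notMem hx, lintegral_zero]
    simp only [key]
    rw [lintegral_indicator measurableSet_Icc, lintegral_mul_const' _ _ ENNReal.ofReal_ne_top,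
      beta_scaled_lintegral (hu 0) hw1 hT, ← ENNReal.ofReal_mul']
    · congr 1
      have hG : Real.Gamma w ≠ 0 := (Real.Gamma_pos_of_pos (by linarith)).ne'
      rw [Fin.sum_univ_succ, Fin.prod_univ_succ,
        show v + (u 0 + ∑ i : Fin d, u i.succ) = u 0 + w by rw [hw]; ring, hc]
      field_simp
    · exact hc0
lemma Sd_closed (d : ℕ) : IsClosed (Sd d) := by rw [Sd_eq_scSet]; exact scSet_closed d 1

lemma Sd_meas (d : ℕ) : MeasurableSet (Sd d) := (Sd_closed d).measurableSet

lemma Sd_compact (d : ℕ) : IsCompact (Sd d) := by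
  refine (isCompact_Icc (a := (0 : Fin d → ℝ)) (b := 1)).of_isClosed_subset (Sd_closed d) ?_
  intro x hx
  exact ⟨fun i => (hx.1 i).1, fun i => (hx.1 i).2⟩

/-- unnormalised Dirichlet function -/
def dirG (d : ℕ) (u : Fin d → ℝ) (v : ℝ) (x : Fin d → ℝ) : ℝ :=
  (1 - ∑ i, x i) ^ (v - 1) * ∏ i, (x i) ^ (u i - 1)

lemma dirG_cont (d : ℕ) (u : Fin d → ℝ) (hu : ∀ i, 1 ≤ u i) (v : ℝ) (hv : 1 ≤ v) :
    Continuous (dirG d u v) := by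
  refine Continuous.mul ((Real.continuous_rpow_const (by linarith)).comp (by fun_prop)) ?_
  refine continuous_finsetProd _ fun i _ => ?_
  exact (Real.continuous_rpow_const (by linarith [hu i])).comp (by fun_prop)

lemma dirG_nonneg (d : ℕ) (u : Fin d → ℝ) (v : ℝ) {x : Fin d → ℝ} (hx : x ∈ Sd d) :
    0 ≤ dirG d u v x :=
  mul_nonneg (Real.rpow_nonneg (by linarith [hx.2]) _)
    (Finset.prod_nonneg fun i _ => Real.rpow_nonneg (hx.1 i).1 _)

lemma integral_dirG (d : ℕ) (u : Fin d → ℝ) (hu : ∀ i, 1 ≤ u i) (v : ℝ) (hv : 1 ≤ v) :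
    ∫ x in Sd d, dirG d u v x =
      (Real.Gamma v * ∏ i, Real.Gamma (u i)) / Real.Gamma (v + ∑ i, u i) := by
  have h := lintegral_dirF d 1 zero_le_one u hu v hv
  have hs : 0 ≤ ∑ i, u i := Finset.sum_nonneg fun i _ => by linarith [hu i]
  unfold dirF at h
  rw [lintegral_indicator (scSet_closed d 1).measurableSet, ← Sd_eq_scSet, Real.one_rpow,
    one_mul] at h
  change ∫⁻ x in Sd d, ENNReal.ofReal (dirG d u v x) = _ at h
  rw [← ofReal_integral_eq_lintegral_ofReal
    ((dirG_cont d u hu v hv).continuousOn.integrableOn_compact (Sd_compact d))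
    ((ae_restrict_mem (Sd_meas d)).mono fun x hx => dirG_nonneg d u v hx)] at h
  rwa [ENNReal.ofReal_eq_ofReal_iff (setIntegral_nonneg (Sd_meas d) fun x hx => dirG_nonneg d u v hx)
    (div_nonneg (mul_nonneg (Real.Gamma_pos_of_pos (by linarith)).le
        (Finset.prod_nonneg fun i _ => (Real.Gamma_pos_of_pos (by linarith [hu i])).le))
        (Real.Gamma_pos_of_pos (by linarith)).le)] at h

lemma integral_dirG_sum (d : ℕ) (u : Fin d → ℝ) (hu : ∀ i, 1 ≤ u i) (v : ℝ) (hv : 1 ≤ v) :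
    ∫ x in Sd d, dirG d u v x * ∑ i, x i =
      (Real.Gamma v * ∏ i, Real.Gamma (u i)) / Real.Gamma (v + ∑ i, u i) *
        ((∑ i, u i) / (v + ∑ i, u i)) := by
  have hs : 0 ≤ ∑ i, u i := Finset.sum_nonneg fun i _ => by linarith [hu i]
  have h1 : ∫ x in Sd d, dirG d u v x * ∑ i, x i =
      ∫ x in Sd d, (dirG d u v x - dirG d u (v + 1) x) := by
    refine setIntegral_congr_fun (Sd_meas d) fun x hx => ?_
    have h2 : (1 - ∑ i, x i) ^ (v + 1 - 1) = (1 - ∑ i, x i) ^ (v - 1) * (1 - ∑ i, x i) := by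
      rw [← Real.rpow_add_one' (by linarith [hx.2]) (by linarith)]
      congr 1; ring
    simp only [dirG, h2]; ring
  rw [h1, integral_sub
    ((dirG_cont d u hu v hv).continuousOn.integrableOn_compact (Sd_compact d))
    ((dirG_cont d u hu (v+1) (by linarith)).continuousOn.integrableOn_compact (Sd_compact d)),
    integral_dirG d u hu v hv, integral_dirG d u hu (v + 1) (by linarith),
    Real.Gamma_add_one (by linarith), show v + 1 + ∑ i, u i = (v + ∑ i, u i) + 1 by ring,
    Real.Gamma_add_one (by linarith)]
  have hG : Real.Gamma (v + ∑ i, u i) ≠ 0 := (Real.Gamma_pos_of_pos (by linarith)).ne'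
  have hG2 : v + ∑ i, u i ≠ 0 := by linarith
  field_simp
  ring

lemma scSet_vol_ne_zero (d : ℕ) {T : ℝ} (hT : 0 < T) : volume (scSet d T) ≠ 0 := by
  have h := lintegral_dirF d T hT.le (fun _ => 1) (fun _ => le_rfl) 1 le_rfl
  simp only [dirF, sub_self, Real.rpow_zero, Finset.prod_const_one, mul_one, ENNReal.ofReal_one,
    Real.Gamma_one] at h
  rw [lintegral_indicator (scSet_closed d T).measurableSet, setLIntegral_const, one_mul] at h
  rw [h]
  have : 0 < T ^ (1 + (∑ i : Fin d, (1:ℝ)) - 1) / Real.Gamma (1 + ∑ i : Fin d, (1:ℝ)) := by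
    apply div_pos (Real.rpow_pos_of_pos hT _) (Real.Gamma_pos_of_pos _)
    simp; positivity
  simpa using this

lemma dirK_eq (d : ℕ) (u : Fin d → ℝ) (v : ℝ) :
    dirK d u v = (Sd d).indicator fun x =>
      Real.Gamma (v + ∑ i, u i) / (Real.Gamma v * ∏ i, Real.Gamma (u i)) * dirG d u v x := by
  unfold dirK dirG
  congr 1
  ext x
  ring

/-- The normalising constant of `f3`. -/
def Cd (d : ℕ) : ℝ := (Nat.factorial (d - 1) : ℝ) * ((d : ℝ) + 1)

lemma Cd_pos (d : ℕ) : 0 < Cd d := by unfold Cd; positivity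

lemma f3_eq (d : ℕ) : f3 d = (Sd d).indicator fun s => Cd d * ∑ i, s i := rfl

lemma f3_integral (d : ℕ) (hd : 1 ≤ d) : ∫ s, f3 d s = 1 := by
  rw [f3_eq, integral_indicator (Sd_meas d), integral_const_mul]
  have h := integral_dirG_sum d (fun _ => 1) (fun _ => le_rfl) 1 le_rfl
  simp only [dirG, sub_self, Real.rpow_zero, Finset.prod_const_one, mul_one, one_mul,
    Real.Gamma_one] at h
  rw [h]
  obtain ⟨k, rfl⟩ : ∃ k, d = k + 1 := ⟨d - 1, by omega⟩
  simp only [Finset.sum_const, Finset.card_univ, Fintype.card_fin, nsmul_eq_mul, mul_one, Cd]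
  rw [add_comm (1:ℝ), Real.Gamma_nat_eq_factorial, Nat.add_sub_cancel, Nat.factorial_succ]
  push_cast
  have : (k.factorial : ℝ) ≠ 0 := by positivity
  field_simp

lemma f3_integrable (d : ℕ) : Integrable (f3 d) := by
  rw [f3_eq, integrable_indicator_iff (Sd_meas d)]
  exact ContinuousOn.integrableOn_compact (Sd_compact d) (by fun_prop)

lemma f3_nonneg (d : ℕ) (s) : 0 ≤ f3 d s := by
  rw [f3_eq]
  refine Set.indicator_nonneg (fun x hx => ?_) s
  exact mul_nonneg (Cd_pos d).le (Finset.sum_nonneg fun i _ => (hx.1 i).1)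

lemma f3_meas (d : ℕ) : Measurable (f3 d) := by
  rw [f3_eq]
  exact Measurable.indicator (by fun_prop) (Sd_meas d)

lemma f3_le (d : ℕ) (s) : f3 d s ≤ Cd d := by
  rw [f3_eq]
  by_cases h : s ∈ Sd d
  · rw [Set.indicator_of_mem h]
    exact mul_le_of_le_one_right (Cd_pos d).le h.2
  · rw [Set.indicator_of_notMem h]; exact (Cd_pos d).le

lemma f3_dirKb (d : ℕ) {b : ℝ} (hb : 0 < b) {s : Fin d → ℝ} (hs : s ∈ Sd d) :
    ∫ x, f3 d x * dirKb d b s x = Cd d * ((∑ i, s i + d * b) / (1 + b * (d + 1))) := by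
  have hu : ∀ i, 1 ≤ s i / b + 1 := fun i => by
    have := div_nonneg (hs.1 i).1 hb.le
    linarith
  have hv : 1 ≤ (1 - ∑ i, s i) / b + 1 := by
    have := div_nonneg (sub_nonneg.2 hs.2) hb.le
    linarith
  have h := integral_dirG_sum d (fun i => s i / b + 1) hu _ hv
  have hU : ∑ i, (s i / b + 1) = (∑ i, s i) / b + d := by
    rw [Finset.sum_add_distrib, Finset.sum_div]; simp
  have hU0 : 0 ≤ ∑ i, s i := Finset.sum_nonneg fun i _ => (hs.1 i).1
  unfold dirKb
  rw [dirK_eq, f3_eq]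
  have e : (fun x => (Sd d).indicator (fun s => Cd d * ∑ i, s i) x * (Sd d).indicator (fun x =>
      Real.Gamma ((1 - ∑ i, s i) / b + 1 + ∑ i, (s i / b + 1)) /
        (Real.Gamma ((1 - ∑ i, s i) / b + 1) * ∏ i, Real.Gamma (s i / b + 1)) *
        dirG d (fun i => s i / b + 1) ((1 - ∑ i, s i) / b + 1) x) x)
      = (Sd d).indicator (fun x => (Cd d * (Real.Gamma ((1 - ∑ i, s i) / b + 1 + ∑ i, (s i / b + 1)) /
        (Real.Gamma ((1 - ∑ i, s i) / b + 1) * ∏ i, Real.Gamma (s i / b + 1)))) *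
        (dirG d (fun i => s i / b + 1) ((1 - ∑ i, s i) / b + 1) x * ∑ i, x i)) := by
    ext x
    by_cases hx : x ∈ Sd d
    · simp only [Set.indicator_of_mem hx]; ring
    · simp only [Set.indicator_of_notMem hx]; ring
  rw [e, integral_indicator (Sd_meas d), integral_const_mul, h]
  have g1 : Real.Gamma ((1 - ∑ i, s i) / b + 1 + ∑ i, (s i / b + 1)) ≠ 0 := by
    refine (Real.Gamma_pos_of_pos ?_).ne'
    rw [hU]; positivity
  have g2 : Real.Gamma ((1 - ∑ i, s i) / b + 1) ≠ 0 := (Real.Gamma_pos_of_pos (by linarith)).ne'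
  have g3 : ∏ i, Real.Gamma (s i / b + 1) ≠ 0 := 
    Finset.prod_ne_zero_iff.2 fun i _ => (Real.Gamma_pos_of_pos (by linarith [hu i])).ne'
  have g4 : (∑ i, (s i / b + 1)) / ((1 - ∑ i, s i) / b + 1 + ∑ i, (s i / b + 1)) =
      (∑ i, s i + d * b) / (1 + b * (d + 1)) := by
    rw [hU, show (1 - ∑ i, s i) / b + 1 + ((∑ i, s i) / b + d) = (1 + b * (d + 1)) / b by
      field_simp; ring, show (∑ i, s i) / b + d = (∑ i, s i + d * b) / b by field_simp]
    rw [div_div_div_cancel_right₀ hb.ne']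
  rw [g4]
  generalize (∑ i, s i + d * b) / (1 + b * (d + 1)) = R
  generalize Real.Gamma ((1 - ∑ i, s i) / b + 1 + ∑ i, (s i / b + 1)) = G1 at *
  generalize Real.Gamma ((1 - ∑ i, s i) / b + 1) = G2 at *
  generalize ∏ i, Real.Gamma (s i / b + 1) = G3 at *
  field_simp

lemma f3_holder (d : ℕ) (hd : 1 ≤ d) (β L : ℝ) (hβ : 2 < β) (hL : 0 < L) :
    f3 d ∈ holderClass d β L := by
  have hm : ∃ k, mOf β = k + 2 := by
    have : 2 < ⌈β⌉₊ := Nat.lt_ceil.2 (by simpa using hβ)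
    exact ⟨mOf β - 2, by unfold mOf; omega⟩
  have heq : Set.EqOn (f3 d) (fun s => Cd d * ∑ i, s i) (interior (Sd d)) := by
    intro s hs
    rw [f3_eq, Set.indicator_of_mem (interior_subset hs)]
  have hcd : ContDiff ℝ (mOf β) (fun s : Fin d → ℝ => Cd d * ∑ i, s i) := by fun_prop
  refine ⟨f3_nonneg d, fun s hs => by rw [f3_eq, Set.indicator_of_notMem hs], ?_,
    hcd.contDiffOn.congr heq, ?_⟩
  · rw [← integral_indicator (Sd_meas d), ← f3_integral d hd]
    congr 1
    rw [f3_eq, Set.indicator_indicator, Set.inter_self]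
  · intro v s hs t ht
    have z : ∀ r ∈ interior (Sd d), Dpartial d (mOf β) (f3 d) v r = 0 := by
      intro r hr
      obtain ⟨k, hk⟩ := hm
      have huo : UniqueDiffOn ℝ (interior (Sd d)) := isOpen_interior.uniqueDiffOn
      have : iteratedFDerivWithin ℝ (mOf β) (f3 d) (interior (Sd d)) r = 0 := by
        rw [iteratedFDerivWithin_congr heq hr, hk, ← norm_eq_zero,
          ← norm_iteratedFDerivWithin_fderivWithin huo hr]
        let A : (Fin d → ℝ) →L[ℝ] ℝ := Cd d • ∑ i, ContinuousLinearMap.proj i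
        have hA : (fun s : Fin d → ℝ => Cd d * ∑ i, s i) = A := by
          ext s; simp [A]
        have hfd : Set.EqOn (fderivWithin ℝ (fun s : Fin d → ℝ => Cd d * ∑ i, s i) (interior (Sd d)))
            (fun _ => A) (interior (Sd d)) := by
          intro y hy
          rw [hA]
          exact A.fderivWithin (huo y hy)
        rw [iteratedFDerivWithin_congr hfd hr, iteratedFDerivWithin_succ_const]
        simp
      rw [Dpartial, this]; simp
    rw [z s hs, z t ht]
    simp only [sub_self, abs_zero]
    exact mul_nonneg hL.le (Real.rpow_nonneg (Finset.sum_nonneg fun i _ => abs_nonneg _) _)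
lemma invGamma_cont : Continuous fun x : ℝ => (Real.Gamma x)⁻¹ := by
  have h : (fun x : ℝ => (Real.Gamma x)⁻¹) = fun x : ℝ => ((Complex.Gamma (x : ℂ))⁻¹).re := by
    ext x
    rw [Complex.Gamma_ofReal, ← Complex.ofReal_inv, Complex.ofReal_re]
  rw [h]
  exact Complex.continuous_re.comp
    (Complex.differentiable_one_div_Gamma.continuous.comp Complex.continuous_ofReal)

lemma Gamma_meas : Measurable Real.Gamma := by
  have := invGamma_cont.measurable.inv
  simpa [Pi.inv_def] using this

lemma dirKb_meas (d : ℕ) (b : ℝ) :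
    Measurable fun q : (Fin d → ℝ) × (Fin d → ℝ) => dirKb d b q.1 q.2 := by
  have hG := Gamma_meas
  have : (fun q : (Fin d → ℝ) × (Fin d → ℝ) => dirKb d b q.1 q.2) =
      (Prod.snd ⁻¹' (Sd d)).indicator (fun q : (Fin d → ℝ) × (Fin d → ℝ) =>
        Real.Gamma (((1 - ∑ i, q.1 i) / b + 1) + ∑ i, (q.1 i / b + 1)) /
          (Real.Gamma ((1 - ∑ i, q.1 i) / b + 1) * ∏ i, Real.Gamma (q.1 i / b + 1)) *
      (1 - ∑ i, q.2 i) ^ (((1 - ∑ i, q.1 i) / b + 1) - 1) *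
        ∏ i, (q.2 i) ^ ((q.1 i / b + 1) - 1)) := by
    ext q
    by_cases hq : q.2 ∈ Sd d
    · rw [Set.indicator_of_mem (by exact hq), dirKb, dirK, Set.indicator_of_mem hq]
    · rw [Set.indicator_of_notMem (by exact hq), dirKb, dirK, Set.indicator_of_notMem hq]
  rw [this]
  refine Measurable.indicator ?_ (measurable_snd (Sd_meas d))
  fun_prop

lemma dirKb_bound (d : ℕ) {b : ℝ} (hb : 0 < b) :
    ∃ M : ℝ, 0 ≤ M ∧ ∀ s ∈ Sd d, ∀ x, |dirKb d b s x| ≤ M := by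
  obtain ⟨G, hG⟩ := (isCompact_Icc (a := (1:ℝ)) (b := 1 / b + 1)).exists_bound_of_continuousOn
    invGamma_cont.continuousOn
  have hG0 : 0 ≤ G := (norm_nonneg _).trans (hG 1 ⟨le_rfl, by
    have : 0 < 1 / b := by positivity
    linarith⟩)
  have hpos : 0 < Real.Gamma (1 / b + 1 + d) := Real.Gamma_pos_of_pos (by positivity)
  refine ⟨Real.Gamma (1 / b + 1 + d) * (G * G ^ d), by positivity, ?_⟩
  intro s hs x
  have hs0 : 0 ≤ ∑ i, s i := Finset.sum_nonneg fun i _ => (hs.1 i).1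
  by_cases hx : x ∈ Sd d
  swap
  · rw [dirKb, dirK, Set.indicator_of_notMem hx, abs_zero]; positivity
  have hx0 : 0 ≤ ∑ i, x i := Finset.sum_nonneg fun i _ => (hx.1 i).1
  have hv : 0 ≤ (1 - ∑ i, s i) / b := div_nonneg (by linarith [hs.2]) hb.le
  have hv' : (1 - ∑ i, s i) / b ≤ 1 / b := by gcongr; linarith
  have hu : ∀ i, 0 ≤ s i / b := fun i => div_nonneg (hs.1 i).1 hb.le
  have hu' : ∀ i, s i / b ≤ 1 / b := fun i => by gcongr; exact (hs.1 i).2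
  rw [dirKb, dirK_eq, Set.indicator_of_mem hx]
  have e : (1 - ∑ i, s i) / b + 1 + ∑ i, (s i / b + 1) = 1 / b + 1 + d := by
    rw [Finset.sum_add_distrib, ← Finset.sum_div]; simp; ring
  rw [e, div_eq_mul_inv, mul_inv, ← Finset.prod_inv_distrib, abs_mul, abs_mul, abs_mul,
    abs_of_pos hpos, Finset.abs_prod, mul_assoc]
  have b1 : |(Real.Gamma ((1 - ∑ i, s i) / b + 1))⁻¹| ≤ G :=
    hG _ ⟨by linarith, by linarith⟩
  have b2 : ∏ i, |(Real.Gamma (s i / b + 1))⁻¹| ≤ G ^ d := by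
    calc ∏ i, |(Real.Gamma (s i / b + 1))⁻¹| ≤ ∏ i : Fin d, G := by
          refine Finset.prod_le_prod (fun i _ => abs_nonneg _) fun i _ => hG _ ⟨?_, ?_⟩
          · linarith [hu i]
          · linarith [hu' i]
      _ = G ^ d := by simp
  have b3 : |dirG d (fun i => s i / b + 1) ((1 - ∑ i, s i) / b + 1) x| ≤ 1 := by
    rw [abs_of_nonneg (dirG_nonneg _ _ _ hx), dirG]
    refine mul_le_one₀ (Real.rpow_le_one (by linarith [hx.2]) (by linarith) (by simpa using hv)) ?_ ?_
    · exact Finset.prod_nonneg fun i _ => Real.rpow_nonneg (hx.1 i).1 _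
    · exact Finset.prod_le_one (fun i _ => Real.rpow_nonneg (hx.1 i).1 _) fun i _ =>
        Real.rpow_le_one (hx.1 i).1 (hx.1 i).2 (by simpa using hu i)
  refine mul_le_mul_of_nonneg_left ?_ hpos.le
  rw [← mul_one (G * G ^ d)]
  refine mul_le_mul (mul_le_mul b1 b2 (Finset.prod_nonneg fun i _ => ?_) hG0) b3 (abs_nonneg _)
    (by positivity)
  exact abs_nonneg _

lemma fhat_meas (d n : ℕ) (b : ℝ) :
    Measurable fun q : (Fin n → Fin d → ℝ) × (Fin d → ℝ) => fhat d n b q.1 q.2 := by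
  have h2 : ∀ i : Fin n, Measurable
      fun q : (Fin n → Fin d → ℝ) × (Fin d → ℝ) => dirKb d b q.2 (q.1 i) := by
    intro i
    have h1 : Measurable fun q : (Fin n → Fin d → ℝ) × (Fin d → ℝ) => (q.2, q.1 i) := by fun_prop
    have h3 := (dirKb_meas d b).comp h1
    simp only [Function.comp_def] at h3
    exact h3
  have h4 := (Finset.measurable_fun_sum Finset.univ fun i _ => h2 i).const_mul ((n : ℝ)⁻¹)
  exact h4

lemma fhat_bound (d n : ℕ) {b M : ℝ} (hM0 : 0 ≤ M) (hM : ∀ s ∈ Sd d, ∀ x, |dirKb d b s x| ≤ M)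
    (X : Fin n → Fin d → ℝ) {s : Fin d → ℝ} (hs : s ∈ Sd d) : |fhat d n b X s| ≤ M := by
  unfold fhat
  rw [abs_mul, abs_of_nonneg (by positivity)]
  rcases Nat.eq_zero_or_pos n with rfl | hn
  · simpa using hM0
  rw [inv_mul_le_iff₀ (by positivity)]
  refine (Finset.abs_sum_le_sum_abs _ _).trans ?_
  refine (Finset.sum_le_sum fun i _ => hM s hs (X i)).trans ?_
  simp

lemma tangent {p t : ℝ} (hp : 1 ≤ p) (ht : 0 < t) (y : ℝ) :
    t ^ p + p * (t ^ p / t) * (y - t) ≤ |y| ^ p := by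
  have h := one_add_mul_self_le_rpow_one_add (s := |y| / t - 1)
    (by have : 0 ≤ |y| / t := by positivity
        linarith) hp
  rw [show 1 + (|y| / t - 1) = |y| / t by ring, Real.div_rpow (abs_nonneg _) ht.le,
    le_div_iff₀ (Real.rpow_pos_of_pos ht _)] at h
  refine le_trans ?_ h
  have h2 : t ^ p + p * (t ^ p / t) * (|y| - t) = (1 + p * (|y| / t - 1)) * t ^ p := by
    field_simp
  rw [← h2]
  have : y ≤ |y| := le_abs_self y
  have h3 : 0 ≤ p * (t ^ p / t) := by positivity
  nlinarith [mul_le_mul_of_nonneg_left this h3]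

lemma Phi_integrable (d n : ℕ) : Integrable fun ω : Fin n → Fin d → ℝ => ∏ i, f3 d (ω i) :=
  Integrable.fintype_prod (f := fun _ => f3 d) fun _ => f3_integrable d

lemma Phi_integral (d n : ℕ) (hd : 1 ≤ d) : ∫ ω : Fin n → Fin d → ℝ, ∏ i, f3 d (ω i) = 1 := by
  rw [integral_fintype_prod_volume_eq_pow, f3_integral d hd, one_pow]

lemma prod_single (d n : ℕ) (k : (Fin d → ℝ) → ℝ) (i : Fin n) (ω : Fin n → Fin d → ℝ) :
    (∏ j, f3 d (ω j)) * k (ω i) = ∏ j, (f3 d (ω j) * if j = i then k (ω j) else 1) := by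
  rw [Finset.prod_mul_distrib, Finset.prod_ite_eq']
  simp

lemma f3_dirKb_integrable (d : ℕ) {b : ℝ} (hb : 0 < b) {s : Fin d → ℝ} (hs : s ∈ Sd d) :
    Integrable fun x => f3 d x * dirKb d b s x := by
  obtain ⟨M, hM0, hM⟩ := dirKb_bound d hb
  refine (f3_integrable d).mul_bdd (c := M) ?_ (ae_of_all _ fun x => hM s hs x)
  exact ((dirKb_meas d b).comp measurable_prodMk_left).aestronglyMeasurable

lemma single_integrable (d n : ℕ) {b : ℝ} (hb : 0 < b) {s : Fin d → ℝ} (hs : s ∈ Sd d) (i : Fin n) :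
    Integrable fun ω : Fin n → Fin d → ℝ => (∏ j, f3 d (ω j)) * dirKb d b s (ω i) := by
  simp only [prod_single]
  refine Integrable.fintype_prod (f := fun j x => f3 d x * if j = i then dirKb d b s x else 1) ?_
  intro j
  by_cases h : j = i
  · simpa [h] using f3_dirKb_integrable d hb hs
  · simpa [h] using f3_integrable d

lemma single_integral (d n : ℕ) (hd : 1 ≤ d) {b : ℝ} {s : Fin d → ℝ} (i : Fin n) :
    ∫ ω : Fin n → Fin d → ℝ, (∏ j, f3 d (ω j)) * dirKb d b s (ω i) =
      ∫ x, f3 d x * dirKb d b s x := by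
  simp only [prod_single]
  rw [integral_fintype_prod_volume_eq_prod
    (f := fun j x => f3 d x * if j = i then dirKb d b s x else 1),
    Finset.prod_eq_single i]
  · simp
  · intro j _ hj
    simp [hj, f3_integral d hd]
  · simp

lemma mean_h (d n : ℕ) (hd : 1 ≤ d) (hn : n ≠ 0) {b : ℝ} (hb : 0 < b) {s : Fin d → ℝ}
    (hs : s ∈ Sd d) :
    ∫ ω : Fin n → Fin d → ℝ, (∏ j, f3 d (ω j)) * (fhat d n b ω s - f3 d s) =
      Cd d * b * ((d - (d + 1) * ∑ i, s i) / (1 + b * (d + 1))) := by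
  have e : ∀ ω : Fin n → Fin d → ℝ, (∏ j, f3 d (ω j)) * (fhat d n b ω s - f3 d s) =
      (n:ℝ)⁻¹ * (∑ i, (∏ j, f3 d (ω j)) * dirKb d b s (ω i)) - (∏ j, f3 d (ω j)) * f3 d s := by
    intro ω
    rw [fhat, ← Finset.mul_sum]; ring
  simp only [e]
  rw [integral_sub ((integrable_finsetSum _ fun i _ => single_integrable d n hb hs i).const_mul _)
    ((Phi_integrable d n).mul_const _), integral_const_mul,
    integral_finsetSum _ fun i _ => single_integrable d n hb hs i, integral_mul_const,
    Phi_integral d n hd]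
  simp only [single_integral d n hd, f3_dirKb d hb hs]
  rw [f3_eq, Set.indicator_of_mem hs]
  simp only [Finset.sum_const, Finset.card_univ, Fintype.card_fin, nsmul_eq_mul]
  have : (n:ℝ) ≠ 0 := by exact_mod_cast hn
  have h2 : 1 + b * ((d:ℝ) + 1) ≠ 0 := by positivity
  field_simp
  ring
lemma h_integrable (d n : ℕ) {b : ℝ} (hb : 0 < b) {A : Set (Fin d → ℝ)} (hA : MeasurableSet A)
    (hAS : A ⊆ Sd d) :
    Integrable (fun q : (Fin n → Fin d → ℝ) × (Fin d → ℝ) =>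
      (∏ i, f3 d (q.1 i)) * (fhat d n b q.1 q.2 - f3 d q.2))
      ((volume : Measure (Fin n → Fin d → ℝ)).prod (volume.restrict A)) := by
  obtain ⟨M, hM0, hM⟩ := dirKb_bound d hb
  have hfin : IsFiniteMeasure (volume.restrict A) :=
    ⟨by rw [Measure.restrict_apply_univ]; exact (measure_mono hAS).trans_lt (Sd_compact d).measure_lt_top⟩
  have hΦ := (Phi_integrable d n).comp_fst (volume.restrict A)
  have hmem : ∀ᵐ q : (Fin n → Fin d → ℝ) × (Fin d → ℝ)
      ∂((volume : Measure (Fin n → Fin d → ℝ)).prod (volume.restrict A)), q.2 ∈ A :=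
    Measure.quasiMeasurePreserving_snd.ae (ae_restrict_mem hA)
  refine hΦ.mul_bdd (c := M + Cd d) ?_ ?_
  · exact ((fhat_meas d n b).sub ((f3_meas d).comp measurable_snd)).aestronglyMeasurable
  · filter_upwards [hmem] with q hq
    rw [Real.norm_eq_abs]
    refine (abs_sub _ _).trans (add_le_add (fhat_bound d n hM0 hM _ (hAS hq)) ?_)
    rw [abs_of_nonneg (f3_nonneg d _)]
    exact f3_le d _

lemma hp_integrable (d n : ℕ) {b p : ℝ} (hb : 0 < b) (hp : 0 ≤ p) :
    Integrable (fun q : (Fin n → Fin d → ℝ) × (Fin d → ℝ) =>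
      (∏ i, f3 d (q.1 i)) * |fhat d n b q.1 q.2 - f3 d q.2| ^ p)
      ((volume : Measure (Fin n → Fin d → ℝ)).prod (volume.restrict (Sd d))) := by
  obtain ⟨M, hM0, hM⟩ := dirKb_bound d hb
  have hfin : IsFiniteMeasure (volume.restrict (Sd d)) :=
    ⟨by rw [Measure.restrict_apply_univ]; exact (Sd_compact d).measure_lt_top⟩
  have hΦ := (Phi_integrable d n).comp_fst (volume.restrict (Sd d))
  have hmem : ∀ᵐ q : (Fin n → Fin d → ℝ) × (Fin d → ℝ)
      ∂((volume : Measure (Fin n → Fin d → ℝ)).prod (volume.restrict (Sd d))), q.2 ∈ Sd d :=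
    Measure.quasiMeasurePreserving_snd.ae (ae_restrict_mem (Sd_meas d))
  refine hΦ.mul_bdd (c := (M + Cd d) ^ p) ?_ ?_
  · have h1 : Measurable fun q : (Fin n → Fin d → ℝ) × (Fin d → ℝ) =>
        fhat d n b q.1 q.2 - f3 d q.2 := (fhat_meas d n b).sub ((f3_meas d).comp measurable_snd)
    exact (by fun_prop : Measurable fun q : (Fin n → Fin d → ℝ) × (Fin d → ℝ) =>
      |fhat d n b q.1 q.2 - f3 d q.2| ^ p).aestronglyMeasurable
  · filter_upwards [hmem] with q hq
    rw [Real.norm_eq_abs, abs_of_nonneg (Real.rpow_nonneg (abs_nonneg _) _)]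
    refine Real.rpow_le_rpow (abs_nonneg _) ?_ hp
    refine (abs_sub _ _).trans (add_le_add (fhat_bound d n hM0 hM _ hq) ?_)
    rw [abs_of_nonneg (f3_nonneg d _)]
    exact f3_le d _

lemma risk_lower (d n : ℕ) (hd : 1 ≤ d) (hn : n ≠ 0) {b p : ℝ} (hb : 0 < b) (hb1 : b < 1)
    (hp : 1 ≤ p) :
    (Cd d / (2 * (d + 2)) * b) ^ p * volume.real (scSet d (1/4)) ≤ lpRiskPow d n b p (f3 d) := by
  set A := scSet d (1/4) with hAdef
  set t := Cd d / (2 * (d + 2)) * b with htdef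
  have hC := Cd_pos d
  have ht : 0 < t := by positivity
  have hA : MeasurableSet A := (scSet_closed d _).measurableSet
  have hAS : A ⊆ Sd d := by
    rw [Sd_eq_scSet]
    intro x hx
    exact ⟨hx.1, hx.2.trans (by norm_num)⟩
  have hfin : IsFiniteMeasure (volume.restrict A) :=
    ⟨by rw [Measure.restrict_apply_univ]; exact (measure_mono hAS).trans_lt (Sd_compact d).measure_lt_top⟩
  have I1 := h_integrable d n hb hA hAS
  have I2 := hp_integrable d n hb (by linarith : 0 ≤ p)
  have I3 : Integrable (fun q : (Fin n → Fin d → ℝ) × (Fin d → ℝ) =>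
      (∏ i, f3 d (q.1 i)) * |fhat d n b q.1 q.2 - f3 d q.2| ^ p)
      ((volume : Measure (Fin n → Fin d → ℝ)).prod (volume.restrict A)) :=
    I2.mono_measure (Measure.prod_mono le_rfl (Measure.restrict_mono hAS le_rfl))
  have IΦ := (Phi_integrable d n).comp_fst (volume.restrict A)
  set K := p * (t ^ p / t) with hK
  have hK0 : 0 ≤ K := by positivity
  have hΦ0 : ∀ ω : Fin n → Fin d → ℝ, 0 ≤ ∏ i, f3 d (ω i) :=
    fun ω => Finset.prod_nonneg fun i _ => f3_nonneg d _
  have step1 : ∫ q : (Fin n → Fin d → ℝ) × (Fin d → ℝ), (∏ i, f3 d (q.1 i)) *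
      |fhat d n b q.1 q.2 - f3 d q.2| ^ p ∂((volume : Measure (Fin n → Fin d → ℝ)).prod
        (volume.restrict A)) ≤ lpRiskPow d n b p (f3 d) := by
    have : lpRiskPow d n b p (f3 d) = ∫ q : (Fin n → Fin d → ℝ) × (Fin d → ℝ),
      (∏ i, f3 d (q.1 i)) * |fhat d n b q.1 q.2 - f3 d q.2| ^ p
        ∂((volume : Measure (Fin n → Fin d → ℝ)).prod (volume.restrict (Sd d))) := by
      rw [integral_prod _ I2, lpRiskPow]
      simp only [integral_const_mul]
    rw [this]
    refine integral_mono_measure (Measure.prod_mono le_rfl (Measure.restrict_mono hAS le_rfl))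
      (ae_of_all _ fun q => mul_nonneg (hΦ0 _) (Real.rpow_nonneg (abs_nonneg _) _)) I2
  have step2 : ∫ q : (Fin n → Fin d → ℝ) × (Fin d → ℝ), ((t ^ p - K * t) * (∏ i, f3 d (q.1 i)) +
      K * ((∏ i, f3 d (q.1 i)) * (fhat d n b q.1 q.2 - f3 d q.2)))
        ∂((volume : Measure (Fin n → Fin d → ℝ)).prod (volume.restrict A)) ≤
      ∫ q : (Fin n → Fin d → ℝ) × (Fin d → ℝ), (∏ i, f3 d (q.1 i)) *
      |fhat d n b q.1 q.2 - f3 d q.2| ^ p ∂((volume : Measure (Fin n → Fin d → ℝ)).prod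
        (volume.restrict A)) := by
    refine integral_mono ((IΦ.const_mul _).add (I1.const_mul _)) I3 fun q => ?_
    have := mul_le_mul_of_nonneg_left (tangent hp ht (fhat d n b q.1 q.2 - f3 d q.2)) (hΦ0 q.1)
    simp only
    linarith
  have step3 : ∫ q : (Fin n → Fin d → ℝ) × (Fin d → ℝ), (∏ i, f3 d (q.1 i))
        ∂((volume : Measure (Fin n → Fin d → ℝ)).prod (volume.restrict A)) = volume.real A := by
    rw [integral_prod _ IΦ]
    simp only [integral_const, smul_eq_mul, integral_const_mul]
    rw [Phi_integral d n hd]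
    simp
  have step4 : t * volume.real A ≤ ∫ q : (Fin n → Fin d → ℝ) × (Fin d → ℝ),
      (∏ i, f3 d (q.1 i)) * (fhat d n b q.1 q.2 - f3 d q.2)
        ∂((volume : Measure (Fin n → Fin d → ℝ)).prod (volume.restrict A)) := by
    rw [integral_prod_symm _ I1]
    calc t * volume.real A = ∫ s in A, t := by simp [mul_comm]
      _ ≤ _ := by
        refine setIntegral_mono_on (integrable_const _) I1.integral_prod_right hA ?_
        intro s hs
        rw [mean_h d n hd hn hb (hAS hs), htdef]
        have hs2 : ∑ i, s i ≤ 1/4 := hs.2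
        have hd1 : (1:ℝ) ≤ d := by exact_mod_cast hd
        have h1 : 1 / (2 * ((d:ℝ) + 2)) ≤ (d - (d + 1) * ∑ i, s i) / (1 + b * (d + 1)) := by
          have hnum : (1:ℝ)/2 ≤ d - (d + 1) * ∑ i, s i := by nlinarith
          have hden : 1 + b * ((d:ℝ) + 1) ≤ d + 2 := by nlinarith
          rw [← div_div]
          exact div_le_div₀ (by linarith) hnum (by positivity) hden
        calc Cd d / (2 * (d + 2)) * b = Cd d * b * (1 / (2 * ((d:ℝ) + 2))) := by ring
          _ ≤ _ := mul_le_mul_of_nonneg_left h1 (by positivity)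
  rw [integral_add (IΦ.const_mul _) (I1.const_mul _), integral_const_mul, integral_const_mul,
    step3] at step2
  have := mul_le_mul_of_nonneg_left step4 hK0
  linarith

lemma risk_zero (d : ℕ) (hd : 1 ≤ d) {p : ℝ} (hp : 1 ≤ p) :
    ∃ c : ℝ, 0 < c ∧ ∀ b, c ≤ lpRiskPow d 0 b p (f3 d) := by
  have hV : 0 < volume.real (Sd d) := by
    rw [Sd_eq_scSet]
    refine ENNReal.toReal_pos (scSet_vol_ne_zero d one_pos) ?_
    rw [← Sd_eq_scSet]; exact (Sd_compact d).measure_ne_top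
  set V := volume.real (Sd d)
  have hfin : IsFiniteMeasure (volume.restrict (Sd d)) :=
    ⟨by rw [Measure.restrict_apply_univ]; exact (Sd_compact d).measure_lt_top⟩
  have ht : 0 < 1 / V := by positivity
  refine ⟨(1 / V) ^ p * V, by positivity, fun b => ?_⟩
  have e : lpRiskPow d 0 b p (f3 d) = ∫ s in Sd d, |f3 d s| ^ p := by
    unfold lpRiskPow fhat
    rw [integral_unique]
    simp [volume_pi, Measure.real]
  rw [e]
  have I : IntegrableOn (f3 d) (Sd d) := (f3_integrable d).integrableOn
  have I1 : ∫ s in Sd d, f3 d s = 1 := by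
    rw [← integral_indicator (Sd_meas d), ← f3_integral d hd]
    congr 1
    rw [f3_eq, Set.indicator_indicator, Set.inter_self]
  have I2 : IntegrableOn (fun s => |f3 d s| ^ p) (Sd d) := by
    refine Integrable.of_bound (C := Cd d ^ p) ?_ (ae_of_all _ fun s => ?_)
    · have := f3_meas d
      exact (by fun_prop : Measurable fun s => |f3 d s| ^ p).aestronglyMeasurable
    · rw [Real.norm_eq_abs, abs_of_nonneg (Real.rpow_nonneg (abs_nonneg _) _)]
      refine Real.rpow_le_rpow (abs_nonneg _) ?_ (by linarith)
      rw [abs_of_nonneg (f3_nonneg d _)]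
      exact f3_le d _
  set K := p * ((1 / V) ^ p / (1 / V))
  have h : ∫ s in Sd d, (((1 / V) ^ p - K * (1 / V)) + K * f3 d s) ≤ ∫ s in Sd d, |f3 d s| ^ p := by
    refine integral_mono ((integrable_const _).add (I.const_mul _)) I2 fun s => ?_
    have : (1 / V) ^ p + K * (f3 d s - 1 / V) ≤ |f3 d s| ^ p := tangent hp ht (f3 d s)
    simp only
    linarith
  rw [integral_add (integrable_const _) (I.const_mul _), integral_const_mul, I1] at h
  simp only [integral_const, smul_eq_mul, measureReal_restrict_apply_univ] at h
  change V * _ + _ ≤ _ at h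
  have h2 : V * (K * (1 / V)) = K := by field_simp
  linarith

/-- Lemma 3.3 (c): for `p ∈ [1,∞)` and `β ∈ (2,∞)`, the density `f_3`
belongs to `Σ(d,β,L)` and `E_3 ‖f̂_{n,b} - f_3‖_p^p ≥ c b^p` for all `b ∈ (0,1)` and all
`n`, where `c > 0` depends only on `d` and `p`. -/
theorem bias_lower_bound_linear (d : ℕ) (hd : 1 ≤ d) (p β L : ℝ)
    (hp : 1 ≤ p) (hβ : 2 < β) (hL : 0 < L) :
    f3 d ∈ holderClass d β L ∧
      ∃ c : ℝ, 0 < c ∧ ∀ b ∈ Set.Ioo (0 : ℝ) 1, ∀ n : ℕ,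
        c * b ^ p ≤ lpRiskPow d n b p (f3 d) := by
  refine ⟨f3_holder d hd β L hβ hL, ?_⟩
  obtain ⟨c0, hc0, h0⟩ := risk_zero d hd hp
  have hC := Cd_pos d
  have hV : 0 < volume.real (scSet d (1/4)) := by
    refine ENNReal.toReal_pos (scSet_vol_ne_zero d (by norm_num)) (ne_of_lt ?_)
    refine (measure_mono (t := Sd d) ?_).trans_lt (Sd_compact d).measure_lt_top
    rw [Sd_eq_scSet]
    exact fun x hx => ⟨hx.1, hx.2.trans (by norm_num)⟩
  set c1 := (Cd d / (2 * (d + 2))) ^ p * volume.real (scSet d (1/4)) with hc1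
  have hc1p : 0 < c1 := by positivity
  refine ⟨min c0 c1, lt_min hc0 hc1p, ?_⟩
  rintro b ⟨hb, hb1⟩ n
  have hbp : 0 ≤ b ^ p := Real.rpow_nonneg hb.le _
  rcases eq_or_ne n 0 with rfl | hn
  · refine le_trans ?_ (h0 b)
    calc min c0 c1 * b ^ p ≤ c0 * 1 := mul_le_mul (min_le_left _ _)
          (Real.rpow_le_one hb.le hb1.le (by linarith)) hbp hc0.le
      _ = c0 := mul_one _
  · refine le_trans ?_ (risk_lower d n hd hn hb hb1 hp)
    rw [Real.mul_rpow (by positivity) hb.le]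
    calc min c0 c1 * b ^ p ≤ c1 * b ^ p := mul_le_mul_of_nonneg_right (min_le_right _ _) hbp
      _ = _ := by rw [hc1]; ring
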